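/- Let n ≥ 2 and let x be an invertible totally nonnegative n×n real matrix. Then x is oscillatory (i.e., some positive integer power of x is totally positive) if and only if the power x^{n−1} is totally positive. -/

import Mathlib

/-- A square real matrix is totally nonnegative if every minor (determinant of a
square submatrix selected by strictly increasing row and column indices) is nonnegative. -/
def TotallyNonneg {n : ℕ} (x : Matrix (Fin n) (Fin n) ℝ) : Prop :=
  ∀ (k : ℕ) (f g : Fin k → Fin n), StrictMono f → StrictMono g →
    0 ≤ (x.submatrix f g).det

/-- A square real matrix is totally positive if every minor is positive. -/
def TotallyPos {n : ℕ} (x : Matrix (Fin n) (Fin n) ℝ) : Prop :=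
  ∀ (k : ℕ) (f g : Fin k → Fin n), StrictMono f → StrictMono g →
    0 < (x.submatrix f g).det

/-- A matrix is oscillatory if some positive integer power of it is totally positive. -/
def Oscillatory {n : ℕ} (x : Matrix (Fin n) (Fin n) ℝ) : Prop :=
  ∃ m : ℕ, 0 < m ∧ TotallyPos (x ^ m)


open Matrix Equiv

/-! ### Products of totally nonnegative matrices -/

/-- A symmetrised form of the Cauchy–Binet formula. -/
theorem factorial_mul_det_mul {ι κ R : Type*} [Fintype ι] [DecidableEq ι] [Fintype κ] [CommRing R]
    (A : Matrix ι κ R) (B : Matrix κ ι R) :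
    (Fintype.card (Perm ι) : R) * (A * B).det =
      ∑ p : ι → κ, (A.submatrix id p).det * (B.submatrix p id).det := by
  have expand : (A * B).det = ∑ p : ι → κ, (∏ i, A i (p i)) * (B.submatrix p id).det := by
    have : A * B = fun i => ∑ j, A i j • B j := by
      ext i l
      simp [Matrix.mul_apply, Finset.sum_apply]
    rw [this]
    refine ((detRowAlternating : (ι → R) [⋀^ι]→ₗ[R] R).toMultilinearMap.map_sum
      (fun i j => A i j • B j)).trans (Finset.sum_congr rfl fun p _ => ?_)
    exact (detRowAlternating : (ι → R) [⋀^ι]→ₗ[R] R).toMultilinearMap.map_smul_univ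
      (fun i => A i (p i)) (fun i => B (p i))
  have shift (σ : Perm ι) : (A * B).det =
      ∑ p : ι → κ, ((Perm.sign σ : ℤ) : R) * (∏ i, A i (p (σ i))) * (B.submatrix p id).det := by
    rw [expand, ← (Equiv.arrowCongr σ (Equiv.refl κ)).symm.sum_comp]
    refine Finset.sum_congr rfl fun p _ => ?_
    have : (B.submatrix ((Equiv.arrowCongr σ (Equiv.refl κ)).symm p) id) =
        (B.submatrix p id).submatrix σ id := by
      ext i j; simp [Equiv.arrowCongr]
    rw [this, det_permute]
    simp [Equiv.arrowCongr]
    ring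
  calc (Fintype.card (Perm ι) : R) * (A * B).det
      = ∑ _σ : Perm ι, (A * B).det := by simp
    _ = ∑ σ : Perm ι, ∑ p : ι → κ,
          ((Perm.sign σ : ℤ) : R) * (∏ i, A i (p (σ i))) * (B.submatrix p id).det :=
        Finset.sum_congr rfl fun σ _ => shift σ
    _ = _ := by
        rw [Finset.sum_comm]
        refine Finset.sum_congr rfl fun p _ => ?_
        rw [← Finset.sum_mul, ← det_transpose (A.submatrix id p), det_apply' (A.submatrix id p)ᵀ]
        rfl

theorem TotallyNonneg.transpose {n : ℕ} {x : Matrix (Fin n) (Fin n) ℝ} (hx : TotallyNonneg x) :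
    TotallyNonneg xᵀ := fun k f g hf hg => by
  rw [← transpose_submatrix, det_transpose]
  exact hx k g f hg hf

theorem TotallyNonneg.submatrix_det_mul_nonneg {n k : ℕ} {x y : Matrix (Fin n) (Fin n) ℝ}
    (hx : TotallyNonneg x) (hy : TotallyNonneg y) {f g : Fin k → Fin n}
    (hf : StrictMono f) (hg : StrictMono g) (p : Fin k → Fin n) :
    0 ≤ (x.submatrix f p).det * (y.submatrix p g).det := by
  by_cases hp : Function.Injective p
  · set σ := Tuple.sort p
    have hmono : StrictMono (p ∘ σ) :=
      (Tuple.monotone_sort p).strictMono_of_injective (hp.comp σ.injective)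
    have h₁ := det_permute' σ (x.submatrix f p)
    have h₂ := det_permute σ (y.submatrix p g)
    rw [submatrix_submatrix] at h₁ h₂
    have := mul_nonneg (hx k f _ hf hmono) (hy k _ g hmono hg)
    have hx' : (x.submatrix f (p ∘ σ)).det = _ := h₁
    have hy' : (y.submatrix (p ∘ σ) g).det = _ := h₂
    rw [hx', hy'] at this
    rcases Int.units_eq_one_or (Perm.sign σ) with h | h <;> simpa [h] using this
  · obtain ⟨i, j, hij, hne⟩ : ∃ i j, p i = p j ∧ i ≠ j := by
      simpa [Function.Injective] using hp
    have : (y.submatrix p g).det = 0 := det_zero_of_row_eq hne (by ext l; simp [hij])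
    simp [this]

theorem TotallyNonneg.mul {n : ℕ} {x y : Matrix (Fin n) (Fin n) ℝ}
    (hx : TotallyNonneg x) (hy : TotallyNonneg y) : TotallyNonneg (x * y) := by
  intro k f g hf hg
  have h := factorial_mul_det_mul (x.submatrix f id) (y.submatrix id g)
  have hpos : (0 : ℝ) < Fintype.card (Perm (Fin k)) := by exact_mod_cast Fintype.card_pos
  rw [submatrix_mul x y f id g Function.bijective_id]
  refine nonneg_of_mul_nonneg_right (a := (Fintype.card (Perm (Fin k)) : ℝ)) ?_ hpos
  rw [h]
  exact Finset.sum_nonneg fun p _ => hx.submatrix_det_mul_nonneg hy hf hg p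

theorem TotallyNonneg.submatrix_det_mul_pos {n k : ℕ} {x y : Matrix (Fin n) (Fin n) ℝ}
    (hx : TotallyNonneg x) (hy : TotallyNonneg y) {f g h : Fin k → Fin n}
    (hf : StrictMono f) (hg : StrictMono g)
    (hxp : 0 < (x.submatrix f h).det) (hyp : 0 < (y.submatrix h g).det) :
    0 < ((x * y).submatrix f g).det := by
  have hcb := factorial_mul_det_mul (x.submatrix f id) (y.submatrix id g)
  rw [submatrix_mul x y f id g Function.bijective_id]
  refine pos_of_mul_pos_right (a := (Fintype.card (Perm (Fin k)) : ℝ)) ?_ (Nat.cast_nonneg _)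
  rw [hcb]
  exact Finset.sum_pos' (fun p _ => hx.submatrix_det_mul_nonneg hy hf hg p)
    ⟨h, Finset.mem_univ _, mul_pos hxp hyp⟩

theorem TotallyNonneg.one {n : ℕ} : TotallyNonneg (1 : Matrix (Fin n) (Fin n) ℝ) := by
  intro k f g hf hg
  by_cases h : ∀ i, ∃ j, g j = f i
  · choose s hs using h
    have hs_mono : StrictMono s := fun i j hij => by
      rw [← hg.lt_iff_lt, hs, hs]; exact hf hij
    have hs_id : s = id := by
      have := Finite.injective_iff_surjective.1 hs_mono.injective
      exact (hs_mono.range_inj strictMono_id).1 (by simp [this.range_eq])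
    have : f = g := by ext i; rw [← hs, hs_id]; rfl
    subst this
    rw [submatrix_one _ hf.injective]
    simp
  · push Not at h
    obtain ⟨i, hi⟩ := h
    rw [det_eq_zero_of_row_eq_zero i fun j => by simpa using one_apply_ne' (hi j)]

theorem TotallyNonneg.pow {n : ℕ} {x : Matrix (Fin n) (Fin n) ℝ} (hx : TotallyNonneg x) (m : ℕ) :
    TotallyNonneg (x ^ m) := by
  induction m with
  | zero => exact TotallyNonneg.one
  | succ m ih => exact pow_succ x m ▸ ih.mul hx

theorem TotallyNonneg.submatrix_det_pow_pos {n k : ℕ} {x : Matrix (Fin n) (Fin n) ℝ}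
    (hx : TotallyNonneg x) (F : ℕ → Fin k → Fin n) (hF : ∀ t, StrictMono (F t))
    (hpos : ∀ t, 0 < (x.submatrix (F t) (F (t + 1))).det) (m : ℕ) :
    0 < ((x ^ m).submatrix (F 0) (F m)).det := by
  induction m with
  | zero => rw [pow_zero, submatrix_one _ (hF 0).injective]; simp
  | succ m ih =>
    rw [pow_succ]
    exact (hx.pow m).submatrix_det_mul_pos hx (hF _) (hF _) ih (hpos m)

/-! ### Vanishing minors -/

theorem Fin.strictMono_insertNth_of_lt {k : ℕ} {α : Type*} [Preorder α] {f : Fin k → α}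
    (hf : StrictMono f) (p : Fin (k + 1)) (a : α) (hlt : ∀ i : Fin k, i.castSucc < p → f i < a)
    (hgt : ∀ i : Fin k, p ≤ i.castSucc → a < f i) :
    StrictMono (p.insertNth (α := fun _ => α) a f) := by
  intro i j hij
  obtain rfl | ⟨i, rfl⟩ := Fin.eq_self_or_eq_succAbove p i
  · obtain rfl | ⟨j, rfl⟩ := Fin.eq_self_or_eq_succAbove i j
    · exact absurd hij (lt_irrefl _)
    · simpa using hgt j (Fin.lt_succAbove_iff_le_castSucc _ _ |>.1 hij)
  · obtain rfl | ⟨j, rfl⟩ := Fin.eq_self_or_eq_succAbove p j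
    · simpa using hlt i (Fin.succAbove_lt_iff_castSucc_lt _ _ |>.1 hij)
    · simpa using hf (Fin.succAbove_lt_succAbove_iff.1 hij)

theorem exists_castSucc_lt_lt_succ {n k : ℕ} {f : Fin (k + 1) → Fin n} {j : Fin n}
    (hj : ∀ i, f i ≠ j) (h0 : f 0 ≤ j) (hl : j ≤ f (Fin.last k)) :
    ∃ i : Fin k, f i.castSucc < j ∧ j < f i.succ := by
  by_contra! h
  have : ∀ i, f i < j := fun i => by
    induction i using Fin.induction with
    | zero => exact lt_of_le_of_ne h0 (hj 0)
    | succ i ih => exact lt_of_le_of_ne (h i ih) (hj _)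
  exact absurd hl (not_le.2 (this _))

/-- If a minor of a totally nonnegative matrix vanishes although the two minors obtained by
deleting its last, respectively first, row and column do not, then every minor with the same
columns and with rows in the range spanned by the given rows vanishes. -/
theorem TotallyNonneg.det_submatrix_eq_zero {n k : ℕ} {x : Matrix (Fin n) (Fin n) ℝ}
    (hx : TotallyNonneg x) {f g h : Fin (k + 1) → Fin n} (hf : StrictMono f) (hg : StrictMono g)
    (hdet : (x.submatrix f g).det = 0)
    (hinit : 0 < (x.submatrix (f ∘ Fin.castSucc) (g ∘ Fin.castSucc)).det)
    (htail : 0 < (x.submatrix (f ∘ Fin.succ) (g ∘ Fin.succ)).det)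
    (hlow : ∀ i, f 0 ≤ h i) (hhigh : ∀ i, h i ≤ f (Fin.last k)) :
    (x.submatrix h g).det = 0 := by
  set m : Fin (k + 1) → ℝ :=
    fun l => (x.submatrix (f ∘ Fin.castSucc) (g ∘ l.succAbove)).det with hm
  set c : Fin (k + 1) → ℝ := fun l => (-1) ^ (l : ℕ) * m l with hc
  have hm_nonneg (l) : 0 ≤ m l :=
    hx _ _ _ (hf.comp (Fin.strictMono_castSucc)) (hg.comp (Fin.strictMono_succAbove l))
  have hm_last : 0 < m (Fin.last k) := by
    simpa [hm, Fin.succAbove_last] using hinit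
  have hexpand (p : Fin (k + 1)) (j : Fin n) :
      (x.submatrix (p.insertNth (α := fun _ => Fin n) j (f ∘ Fin.castSucc)) g).det =
        (-1) ^ (p : ℕ) * ∑ l, x j (g l) * c l := by
    rw [det_succ_row _ p, Finset.mul_sum]
    refine Finset.sum_congr rfl fun l _ => ?_
    have : (x.submatrix (p.insertNth (α := fun _ => Fin n) j (f ∘ Fin.castSucc)) g).submatrix
        p.succAbove l.succAbove = x.submatrix (f ∘ Fin.castSucc) (g ∘ l.succAbove) := by
      ext a b; simp
    rw [this]
    simp [hc, hm, pow_add]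
    ring
  have hrow (i : Fin (k + 1)) : ∑ l, x (f i) (g l) * c l = 0 := by
    have key := hexpand (Fin.last k) (f i)
    have hzero : (x.submatrix ((Fin.last k).insertNth (α := fun _ => Fin n) (f i)
        (f ∘ Fin.castSucc)) g).det = 0 := by
      induction i using Fin.lastCases with
      | last =>
        convert hdet using 3
        ext a
        induction a using Fin.lastCases <;> simp [Fin.insertNth_last']
      | cast i =>
        refine det_zero_of_row_eq (Fin.castSucc_lt_last i).ne ?_
        ext l
        simp [Fin.insertNth_last']
    rw [hzero] at key
    simpa using key.symm
  have hvanish (j : Fin n) (h0 : f 0 ≤ j) (hl : j ≤ f (Fin.last k)) :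
      ∑ l, x j (g l) * c l = 0 := by
    by_cases hj : ∃ i, f i = j
    · obtain ⟨i, rfl⟩ := hj
      exact hrow i
    push Not at hj
    obtain ⟨i, hi₁, hi₂⟩ := exists_castSucc_lt_lt_succ hj h0 hl
    have hM₁ : StrictMono (i.succ.insertNth (α := fun _ => Fin n) j (f ∘ Fin.castSucc)) :=
      Fin.strictMono_insertNth_of_lt (hf.comp Fin.strictMono_castSucc) _ _
        (fun a ha => (hf.monotone (Fin.le_castSucc_iff.2 ha)).trans_lt hi₁)
        (fun a ha => hi₂.trans_le (hf.monotone (by simpa using ha)))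
    have hM₂ : StrictMono (i.castSucc.insertNth (α := fun _ => Fin n) j (f ∘ Fin.succ)) :=
      Fin.strictMono_insertNth_of_lt (hf.comp Fin.strictMono_succ) _ _
        (fun a ha => (hf.monotone (Fin.succ_le_castSucc_iff.2 (by simpa using ha))).trans_lt hi₁)
        (fun a ha => hi₂.trans_le (hf.monotone (by simpa using ha)))
    set D := ∑ l, x j (g l) * c l with hD
    have h₁ := hx _ _ _ hM₁ hg
    rw [hexpand, ← hD] at h₁
    set M := x.submatrix (i.castSucc.insertNth (α := fun _ => Fin n) j (f ∘ Fin.succ)) g with hMdef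
    have h₂ : 0 ≤ M.det := hx _ _ _ hM₂ hg
    have hMc : M *ᵥ c = Pi.single i.castSucc D := by
      ext a
      rcases Fin.eq_self_or_eq_succAbove i.castSucc a with rfl | ⟨a, rfl⟩
      · simp [hMdef, mulVec, dotProduct, hD]
      · simp [hMdef, mulVec, dotProduct, hrow]
    have hadj : M.det * c 0 = M.adjugate 0 i.castSucc * D := by
      have := congrFun (congrArg (M.adjugate *ᵥ ·) hMc) 0
      simpa [mulVec_mulVec, adjugate_mul, smul_mulVec] using this
    rw [adjugate_fin_succ_eq_det_submatrix] at hadj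
    have hsub : M.submatrix i.castSucc.succAbove (Fin.succAbove 0) =
        x.submatrix (f ∘ Fin.succ) (g ∘ Fin.succ) := by
      ext a b; simp [hMdef]
    rw [hsub] at hadj
    have hc0 : c 0 = m 0 := by simp [hc]
    rw [hc0] at hadj
    have h₃ := mul_nonneg h₂ (hm_nonneg 0)
    rw [hadj] at h₃
    simp only [Fin.val_castSucc, Fin.val_zero, add_zero, Fin.val_succ, pow_succ] at h₁ h₃
    have h₄ : 0 ≤ (-1) ^ (i : ℕ) * D := by
      refine nonneg_of_mul_nonneg_right (a := (x.submatrix (f ∘ Fin.succ) (g ∘ Fin.succ)).det)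
        ?_ htail
      linarith
    have h₅ : (-1 : ℝ) ^ (i : ℕ) * D = 0 := by linarith
    simpa using h₅
  refine exists_mulVec_eq_zero_iff.1 ⟨c, fun h => ?_, ?_⟩
  · have := congrFun h (Fin.last k)
    simp [hc, hm_last.ne'] at this
  · ext i
    simpa [mulVec, dotProduct] using hvanish (h i) (hlow i) (hhigh i)

/-! ### Principal minors -/

/-- The Schur complement of the upper left entry. -/
noncomputable def headSchur {n : ℕ} (x : Matrix (Fin (n + 1)) (Fin (n + 1)) ℝ) :
    Matrix (Fin n) (Fin n) ℝ :=
  fun i j => x i.succ j.succ - x i.succ 0 / x 0 0 * x 0 j.succ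

theorem det_eq_mul_det_headSchur {n : ℕ} {x : Matrix (Fin (n + 1)) (Fin (n + 1)) ℝ}
    (h : x 0 0 ≠ 0) : x.det = x 0 0 * (headSchur x).det := by
  set c : Fin (n + 1) → ℝ := Fin.cons 0 fun i => x i.succ 0 / x 0 0 with hc
  rw [det_eq_of_forall_row_eq_smul_add_const (B := of fun i j => x i j - c i * x 0 j) c 0
    (by simp [hc]) (by simp [hc]), det_succ_column_zero, Fin.sum_univ_succ]
  rw [Finset.sum_eq_zero fun i _ => by simp [hc, h]]
  simp only [Fin.val_zero, pow_zero, one_mul, add_zero]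
  congr 1
  simp [hc]

theorem det_submatrix_cons_zero {n k : ℕ} {x : Matrix (Fin (n + 1)) (Fin (n + 1)) ℝ}
    (h : x 0 0 ≠ 0) {f g : Fin (k + 1) → Fin (n + 1)} {f' g' : Fin k → Fin n}
    (hf0 : f 0 = 0) (hg0 : g 0 = 0) (hf : ∀ i, f i.succ = (f' i).succ)
    (hg : ∀ i, g i.succ = (g' i).succ) :
    (x.submatrix f g).det = x 0 0 * ((headSchur x).submatrix f' g').det := by
  rw [det_eq_mul_det_headSchur (by simpa [hf0, hg0] using h)]
  have : headSchur (x.submatrix f g) = (headSchur x).submatrix f' g' := by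
    ext i j
    simp [headSchur, hf0, hg0, hf, hg]
  rw [this, submatrix_apply, hf0, hg0]

theorem TotallyNonneg.headSchur {n : ℕ} {x : Matrix (Fin (n + 1)) (Fin (n + 1)) ℝ}
    (hx : TotallyNonneg x) (h : 0 < x 0 0) : TotallyNonneg (headSchur x) := by
  intro k f g hf hg
  have hmono {f : Fin k → Fin n} (hf : StrictMono f) :
      StrictMono (Fin.cons 0 (Fin.succ ∘ f) : Fin (k + 1) → Fin (n + 1)) :=
    Fin.strictMono_cons.2 ⟨fun j => Fin.succ_pos _, Fin.strictMono_succ.comp hf⟩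
  have := hx _ _ _ (hmono hf) (hmono hg)
  rw [det_submatrix_cons_zero h.ne' (f' := f) (g' := g) (by simp) (by simp) (by simp)
    (by simp)] at this
  exact nonneg_of_mul_nonneg_right this h

theorem TotallyNonneg.submatrix {n m : ℕ} {x : Matrix (Fin n) (Fin n) ℝ} (hx : TotallyNonneg x)
    {f g : Fin m → Fin n} (hf : StrictMono f) (hg : StrictMono g) :
    TotallyNonneg (x.submatrix f g) := fun k f' g' hf' hg' => by
  simpa [submatrix_submatrix] using hx k _ _ (hf.comp hf') (hg.comp hg')

theorem TotallyNonneg.submatrix_rev {n : ℕ} {x : Matrix (Fin n) (Fin n) ℝ}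
    (hx : TotallyNonneg x) : TotallyNonneg (x.submatrix Fin.rev Fin.rev) := by
  intro k f g hf hg
  have hmono {f : Fin k → Fin n} (hf : StrictMono f) : StrictMono (Fin.rev ∘ f ∘ Fin.rev) :=
    fun i j hij => Fin.rev_lt_rev.2 (hf (Fin.rev_lt_rev.2 hij))
  have := hx _ _ _ (hmono hf) (hmono hg)
  rw [← det_submatrix_equiv_self Fin.revPerm] at this
  convert this using 2
  ext i j
  simp

theorem TotallyNonneg.apply_nonneg {n : ℕ} {x : Matrix (Fin n) (Fin n) ℝ} (hx : TotallyNonneg x)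
    (i j : Fin n) : 0 ≤ x i j := by
  simpa using hx 1 (fun _ => i) (fun _ => j) (Subsingleton.strictMono _) (Subsingleton.strictMono _)

theorem TotallyNonneg.mul_le_mul {n : ℕ} {x : Matrix (Fin n) (Fin n) ℝ} (hx : TotallyNonneg x)
    {i i' j j' : Fin n} (hi : i < i') (hj : j < j') : x i j' * x i' j ≤ x i j * x i' j' := by
  have := hx 2 ![i, i'] ![j, j'] (by simpa using hi) (by simpa using hj)
  rw [det_fin_two] at this
  simpa using this

theorem TotallyNonneg.apply_zero_zero_pos {n : ℕ} {x : Matrix (Fin (n + 1)) (Fin (n + 1)) ℝ}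
    (hx : TotallyNonneg x) (hdet : x.det ≠ 0) : 0 < x 0 0 := by
  refine (hx.apply_nonneg 0 0).lt_of_ne' fun h0 => ?_
  obtain ⟨j, hj⟩ : ∃ j, x 0 j ≠ 0 := by
    by_contra! h
    exact hdet (det_eq_zero_of_row_eq_zero 0 h)
  have hjpos : 0 < j := Fin.pos_of_ne_zero fun h => hj (h ▸ h0)
  refine hdet (det_eq_zero_of_column_eq_zero 0 fun i => ?_)
  rcases eq_or_ne i 0 with rfl | hi
  · exact h0
  have := hx.mul_le_mul (Fin.pos_of_ne_zero hi) hjpos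
  rw [h0, zero_mul] at this
  exact (mul_eq_zero.1 (this.antisymm (mul_nonneg (hx.apply_nonneg _ _)
    (hx.apply_nonneg _ _)))).resolve_left hj

theorem TotallyNonneg.det_headSchur_ne_zero {n : ℕ}
    {x : Matrix (Fin (n + 1)) (Fin (n + 1)) ℝ} (hx : TotallyNonneg x) (hdet : x.det ≠ 0) :
    (_root_.headSchur x).det ≠ 0 :=
  right_ne_zero_of_mul (det_eq_mul_det_headSchur (hx.apply_zero_zero_pos hdet).ne' ▸ hdet)

theorem TotallyNonneg.det_submatrix_castSucc_ne_zero {n : ℕ}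
    {x : Matrix (Fin (n + 1)) (Fin (n + 1)) ℝ} (hx : TotallyNonneg x) (hdet : x.det ≠ 0) :
    (x.submatrix Fin.castSucc Fin.castSucc).det ≠ 0 := by
  induction n with
  | zero => simp
  | succ n ih =>
    have h := hx.apply_zero_zero_pos hdet
    rw [det_submatrix_cons_zero h.ne' (f' := Fin.castSucc) (g' := Fin.castSucc) (by simp)
      (by simp) (by simp) (by simp)]
    exact mul_ne_zero h.ne' (ih (hx.headSchur h) (hx.det_headSchur_ne_zero hdet))

theorem TotallyNonneg.det_submatrix_succ_ne_zero {n : ℕ}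
    {x : Matrix (Fin (n + 1)) (Fin (n + 1)) ℝ} (hx : TotallyNonneg x) (hdet : x.det ≠ 0) :
    (x.submatrix Fin.succ Fin.succ).det ≠ 0 := by
  have := hx.submatrix_rev.det_submatrix_castSucc_ne_zero
    ((det_submatrix_equiv_self Fin.revPerm x).trans_ne hdet)
  rw [← det_submatrix_equiv_self Fin.revPerm] at this
  convert this using 2
  ext i j
  simp [Fin.rev_castSucc]

theorem TotallyNonneg.det_submatrix_self_pos {n k : ℕ} {x : Matrix (Fin n) (Fin n) ℝ}
    (hx : TotallyNonneg x) (hdet : x.det ≠ 0) {f : Fin k → Fin n} (hf : StrictMono f) :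
    0 < (x.submatrix f f).det := by
  refine (hx k f f hf hf).lt_of_ne' ?_
  induction n generalizing k with
  | zero =>
    cases k with
    | zero => simp
    | succ k => exact (f 0).elim0
  | succ n ih =>
    have hsucc {m : ℕ} {g : Fin m → Fin (n + 1)} (hg : StrictMono g) (h : ∀ i, g i ≠ 0) :
        ∃ g' : Fin m → Fin n, StrictMono g' ∧ ∀ i, g i = (g' i).succ :=
      ⟨fun i => (g i).pred (h i), fun i j hij => Fin.pred_lt_pred_iff.2 (hg hij), by simp⟩
    by_cases h0 : ∀ i, f i ≠ 0
    · obtain ⟨f', hf', hff'⟩ := hsucc hf h0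
      have := ih (hx.submatrix Fin.strictMono_succ Fin.strictMono_succ)
        (hx.det_submatrix_succ_ne_zero hdet) hf'
      convert this using 2
      ext i j
      simp [hff']
    · push Not at h0
      obtain ⟨i, hi⟩ := h0
      cases k with
      | zero => exact i.elim0
      | succ k =>
        have hf0 : f 0 = 0 := le_antisymm (hi ▸ hf.monotone (Fin.zero_le i)) (Fin.zero_le _)
        obtain ⟨f', hf', hff'⟩ := hsucc (hf.comp Fin.strictMono_succ) fun i =>
          (hf0 ▸ hf (Fin.succ_pos i)).ne'
        have h := hx.apply_zero_zero_pos hdet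
        rw [det_submatrix_cons_zero h.ne' hf0 hf0 hff' hff']
        exact mul_ne_zero h.ne' (ih (hx.headSchur h) (hx.det_headSchur_ne_zero hdet) hf')

/-! ### Positive minors with interlacing indices -/

theorem TotallyNonneg.det_submatrix_pos_of_interlacing {n k : ℕ} {x : Matrix (Fin n) (Fin n) ℝ}
    (hx : TotallyNonneg x) (hdet : x.det ≠ 0) {f g : Fin k → Fin n} (hf : StrictMono f)
    (hg : StrictMono g) (hfg : ∀ i j, i < j → f i < g j) (hgf : ∀ i j, i < j → g i < f j)
    (hpos : ∀ i, 0 < x (f i) (g i)) : 0 < (x.submatrix f g).det := by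
  induction k with
  | zero => simp
  | succ k ih =>
    rcases k with _ | k
    · simpa using hpos 0
    refine (hx _ f g hf hg).lt_of_ne' fun hzero => ?_
    set h : Fin (k + 2) → Fin n := fun i => if i = 0 then max (f 0) (g 0) else min (f i) (g i)
      with hdef
    have h0 : h 0 = max (f 0) (g 0) := by simp [hdef]
    have hs {i} (hi : 0 < i) : h i = min (f i) (g i) := by simp [hdef, hi.ne']
    have hh : StrictMono h := fun i j hij => by
      rw [hs ((Fin.zero_le i).trans_lt hij)]
      rcases (Fin.zero_le i).eq_or_lt with rfl | hi
      · simp [h0, hf hij, hg hij, hfg _ _ hij, hgf _ _ hij]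
      · simp [hs hi, hf hij, hg hij]
    have hhg (i j) (hij : i < j) : h i < g j := by
      rcases (Fin.zero_le i).eq_or_lt with rfl | hi
      · simp [h0, hg hij, hfg _ _ hij]
      · simp [hs hi, hg hij]
    have hgh (i j) (hij : i < j) : g i < h j := by
      simp [hs ((Fin.zero_le i).trans_lt hij), hg hij, hgf _ _ hij]
    have hbound {u : Fin (k + 2) → Fin n} (hu : StrictMono u) (hu0 : u 0 ≤ h 0)
        (hul : h (Fin.last _) ≤ u (Fin.last _)) (i) : u 0 ≤ h i ∧ h i ≤ u (Fin.last _) :=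
      ⟨hu0.trans (hh.monotone (Fin.zero_le i)), (hh.monotone (Fin.le_last i)).trans hul⟩
    have hbf := hbound hf (by simp [h0]) (by simp [hs (Fin.last_pos)])
    have hbg := hbound hg (by simp [h0]) (by simp [hs (Fin.last_pos)])
    have hposh (i) : 0 < x (h i) (g i) := by
      have hd : 0 < x (g i) (g i) := by
        simpa using hx.det_submatrix_self_pos hdet (f := fun _ : Fin 1 => g i)
          (Subsingleton.strictMono _)
      have : h i = f i ∨ h i = g i := by
        rcases (Fin.zero_le i).eq_or_lt with rfl | hi
        · rw [h0]; exact max_choice _ _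
        · rw [hs hi]; exact min_choice _ _
      rcases this with h | h <;> rw [h]
      exacts [hpos i, hd]
    have hsub {u : Fin (k + 2) → Fin n} (hu : StrictMono u) (hug : ∀ i j, i < j → u i < g j)
        (hgu : ∀ i j, i < j → g i < u j) (hup : ∀ i, 0 < x (u i) (g i))
        {s : Fin (k + 1) → Fin (k + 2)} (hs : StrictMono s) :
        0 < (x.submatrix (u ∘ s) (g ∘ s)).det :=
      ih (hu.comp hs) (hg.comp hs) (fun i j hij => hug _ _ (hs hij))
        (fun i j hij => hgu _ _ (hs hij)) fun i => hup _
    have hzero' : (x.submatrix h g).det = 0 :=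
      hx.det_submatrix_eq_zero hf hg hzero (hsub hf hfg hgf hpos Fin.strictMono_castSucc)
        (hsub hf hfg hgf hpos Fin.strictMono_succ) (fun i => (hbf i).1) fun i => (hbf i).2
    have htr {m : ℕ} (a b : Fin m → Fin n) : (xᵀ.submatrix a b).det = (x.submatrix b a).det := by
      rw [← transpose_submatrix, det_transpose]
    have hzero'' : (x.submatrix h h).det = 0 := by
      rw [← htr]
      refine hx.transpose.det_submatrix_eq_zero hg hh ?_ ?_ ?_ (fun i => (hbg i).1)
        fun i => (hbg i).2
      · rwa [htr]
      · rw [htr]; exact hsub hh hhg hgh hposh Fin.strictMono_castSucc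
      · rw [htr]; exact hsub hh hhg hgh hposh Fin.strictMono_succ
    exact (hx.det_submatrix_self_pos hdet hh).ne' hzero''

/-! ### Moving one index set to another by interlacing steps -/

theorem StrictMono.fin_add_sub_le {n k : ℕ} {f : Fin k → Fin n} (hf : StrictMono f) (i j : Fin k)
    (hij : i ≤ j) : (f i : ℕ) + (j - i) ≤ f j := by
  obtain ⟨i, hi⟩ := i
  obtain ⟨j, hj⟩ := j
  have hij' : i ≤ j := hij
  clear hij
  induction j, hij' using Nat.le_induction with
  | base => simp
  | succ j hle ih =>
    have h₁ := ih (by omega)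
    have h₂ : (f ⟨j, by omega⟩ : ℕ) < f ⟨j + 1, hj⟩ := hf (by simp)
    simp only at h₁ h₂ ⊢
    omega

/-- The positions at time `t` of particles moving from `a` to `b`: upwards moving particles follow
the line `t + 2 * i + 1 - k` and downwards moving ones the line `n + 2 * i - k - t`. -/
def particlePath (n k a b i t : ℕ) : ℕ :=
  if a ≤ b then max a (min b (t + 2 * i + 1 - k)) else min a (max b (n + 2 * i - k - t))

theorem particlePath_lt {n k a b i t : ℕ} (ha : a < n) (hb : b < n) :
    particlePath n k a b i t < n := by
  unfold particlePath; split_ifs <;> omega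

theorem exists_interlacing_path {n k : ℕ} {f g : Fin k → Fin n} (hf : StrictMono f)
    (hg : StrictMono g) :
    ∃ F : ℕ → Fin k → Fin n, F 0 = f ∧ F (n - 1) = g ∧ (∀ t, StrictMono (F t)) ∧
      (∀ t i j, i < j → F t i < F (t + 1) j) ∧ (∀ t i j, i < j → F (t + 1) i < F t j) ∧
      ∀ t i, (F t i : ℕ) ≤ F (t + 1) i + 1 ∧ (F (t + 1) i : ℕ) ≤ F t i + 1 := by
  have hbounds {f : Fin k → Fin n} (hf : StrictMono f) (i : Fin k) :
      (i : ℕ) ≤ f i ∧ f i + k ≤ n + i ∧ i < k := by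
    have hk : 0 < k := i.pos
    have h₁ := hf.fin_add_sub_le ⟨0, hk⟩ i (Fin.le_def.2 (Nat.zero_le _))
    have h₂ := hf.fin_add_sub_le i ⟨k - 1, by omega⟩ (Fin.le_def.2 (by simp; omega))
    have h₃ := (f ⟨k - 1, by omega⟩).isLt
    simp only at h₁ h₂
    omega
  refine ⟨fun t i => ⟨particlePath n k (f i) (g i) i t, particlePath_lt (f i).isLt (g i).isLt⟩,
    ?_, ?_, fun t i j hij => ?_, fun t i j hij => ?_, fun t i j hij => ?_, fun t i => ?_⟩
  · ext i
    have := hbounds hf i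
    have := hbounds hg i
    simp only [particlePath]; split_ifs <;> omega
  · ext i
    have := hbounds hf i
    have := hbounds hg i
    simp only [particlePath]; split_ifs <;> omega
  all_goals first
    | have := hbounds hf i
      have := hbounds hg i
      have := hbounds hf j
      have := hbounds hg j
      have : (f i : ℕ) < f j := hf hij
      have : (g i : ℕ) < g j := hg hij
      have : (i : ℕ) < j := hij
      simp only [Fin.mk_lt_mk, particlePath]
      split_ifs <;> omega
    | simp only [particlePath]
      split_ifs <;> omega

theorem TotallyNonneg.totallyPos_pow {n : ℕ} {x : Matrix (Fin n) (Fin n) ℝ}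
    (hx : TotallyNonneg x) (hdet : x.det ≠ 0)
    (hpos : ∀ i j : Fin n, (i : ℕ) + 1 = j → 0 < x i j ∧ 0 < x j i) :
    TotallyPos (x ^ (n - 1)) := by
  intro k f g hf hg
  obtain ⟨F, rfl, rfl, hmono, hlt, hgt, hstep⟩ := exists_interlacing_path hf hg
  refine hx.submatrix_det_pow_pos F hmono (fun t => ?_) _
  refine hx.det_submatrix_pos_of_interlacing hdet (hmono _) (hmono _) (hlt t) (hgt t) fun i => ?_
  have := hstep t i
  rcases lt_trichotomy (F t i : ℕ) (F (t + 1) i) with h | h | h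
  · exact (hpos _ _ (by omega)).1
  · rw [← Fin.ext h]
    simpa using hx.det_submatrix_self_pos hdet (f := fun _ : Fin 1 => F t i)
      (Subsingleton.strictMono _)
  · exact (hpos _ _ (by omega)).2

/-! ### Oscillatory matrices -/

theorem TotallyNonneg.pow_apply_eq_zero {n : ℕ} {x : Matrix (Fin n) (Fin n) ℝ}
    (hx : TotallyNonneg x) (hdet : x.det ≠ 0) {i j : Fin n} (hij : (i : ℕ) + 1 = j)
    (h0 : x i j = 0) (m : ℕ) {a b : Fin n} (ha : a ≤ i) (hb : j ≤ b) : (x ^ m) a b = 0 := by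
  have hdiag (l) : 0 < x l l := by
    simpa using hx.det_submatrix_self_pos hdet (f := fun _ : Fin 1 => l)
      (Subsingleton.strictMono _)
  have hlt : i < j := Fin.lt_def.2 (by omega)
  have hrow {b} (hb : j ≤ b) : x i b = 0 := by
    rcases hb.eq_or_lt with rfl | hb
    · exact h0
    have := hx.mul_le_mul hlt hb
    rw [h0, zero_mul] at this
    exact le_antisymm (nonpos_of_mul_nonpos_left this (hdiag j)) (hx.apply_nonneg _ _)
  have hblock {a b} (ha : a ≤ i) (hb : j ≤ b) : x a b = 0 := by
    rcases ha.eq_or_lt with rfl | ha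
    · exact hrow hb
    have := hx.mul_le_mul ha (hlt.trans_le hb)
    rw [hrow hb, mul_zero] at this
    exact le_antisymm (nonpos_of_mul_nonpos_left this (hdiag i)) (hx.apply_nonneg _ _)
  induction m generalizing a b with
  | zero => exact one_apply_ne ((ha.trans_lt hlt).trans_le hb).ne
  | succ m ih =>
    rw [pow_succ, mul_apply]
    refine Finset.sum_eq_zero fun l _ => ?_
    rcases le_or_gt l i with hl | hl
    · rw [hblock hl hb, mul_zero]
    · rw [ih ha (Fin.le_def.2 (by rw [Fin.lt_def] at hl; omega)), zero_mul]

theorem TotallyPos.apply_pos {n : ℕ} {x : Matrix (Fin n) (Fin n) ℝ} (hx : TotallyPos x)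
    (i j : Fin n) : 0 < x i j := by
  simpa using hx 1 (fun _ => i) (fun _ => j) (Subsingleton.strictMono _) (Subsingleton.strictMono _)

theorem Oscillatory.apply_pos {n : ℕ} {x : Matrix (Fin n) (Fin n) ℝ} (h : Oscillatory x)
    (hx : TotallyNonneg x) (hdet : x.det ≠ 0) {i j : Fin n} (hij : (i : ℕ) + 1 = j) :
    0 < x i j ∧ 0 < x j i := by
  obtain ⟨m, -, hm⟩ := h
  refine ⟨(hx.apply_nonneg _ _).lt_of_ne' fun h0 => (hm.apply_pos i j).ne' ?_,
    (hx.apply_nonneg _ _).lt_of_ne' fun h0 => (hm.apply_pos j i).ne' ?_⟩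
  · exact hx.pow_apply_eq_zero hdet hij h0 m le_rfl le_rfl
  · rw [← transpose_apply (x ^ m), transpose_pow]
    exact hx.transpose.pow_apply_eq_zero (by rwa [det_transpose]) hij h0 m le_rfl le_rfl

/-- Gantmacher–Krein: an invertible totally nonnegative matrix is oscillatory iff
its `(n-1)`-st power is totally positive. -/
theorem stmt5 (n : ℕ) (hn : 2 ≤ n) (x : Matrix (Fin n) (Fin n) ℝ)
    (hx : IsUnit x) (htnn : TotallyNonneg x) :
    Oscillatory x ↔ TotallyPos (x ^ (n - 1)) := by
  have hdet : x.det ≠ 0 := ((isUnit_iff_isUnit_det x).1 hx).ne_zero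
  exact ⟨fun h => htnn.totallyPos_pow hdet fun i j hij => h.apply_pos htnn hdet hij,
    fun h => ⟨n - 1, by omega, h⟩⟩
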